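/- ∑_{k=0}^∞ (3/2)_k^3 / [(k!)^2 · (k+1)!] · (2k+1)/4^k = 32/(3π). -/

import Mathlib

/-- The Pochhammer symbol `(x)ₖ = x (x+1) ⋯ (x+k-1)`, with `(x)₀ = 1`. -/
noncomputable def poch (x : ℝ) (k : ℕ) : ℝ :=
  ∏ i ∈ Finset.range k, (x + i)

open Filter Topology

/-- The hypergeometric coefficient
`(-1/2)ₖ (3/2)ₖ² / (k! (m+2)ₖ (m+1)ₖ 4ᵏ)`, defined by its recurrence in `k`. -/
noncomputable def wzCoeff (m : ℕ) : ℕ → ℝ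
  | 0 => 1
  | k + 1 => wzCoeff m k *
      (((k : ℝ) - 1 / 2) * ((k : ℝ) + 3 / 2) ^ 2 /
        (((k : ℝ) + 1) * ((m : ℝ) + 2 + k) * ((m : ℝ) + 1 + k) * 4))

/-- The polynomial factor of the summand `wzTerm`. -/
noncomputable def wzPoly (m k : ℕ) : ℝ :=
  (4 * (m : ℝ) + 6 * k + 3) * (4 * (m : ℝ) + 2 * k - 1) * (4 * (m : ℝ) + 2 * k + 1)

/-- The first member of the Wilf–Zeilberger pair. -/
noncomputable def wzTerm (m k : ℕ) : ℝ := wzCoeff m k * wzPoly m k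

/-- The second member of the Wilf–Zeilberger pair. -/
noncomputable def wzCert (m k : ℕ) : ℝ :=
  wzCoeff m k *
    (((m : ℝ) + 1) * ((m : ℝ) + 2) * k * (32 * (4 * (m : ℝ) + 2 * k + 1) ^ 2))

lemma abs_wzCoeff_le (m k : ℕ) : |wzCoeff m k| ≤ (1 / 2 : ℝ) ^ k := by
  induction k with
  | zero => simp [wzCoeff]
  | succ k ih =>
    have hk : (0 : ℝ) ≤ k := k.cast_nonneg
    have hm : (0 : ℝ) ≤ m := m.cast_nonneg
    rw [wzCoeff, abs_mul, pow_succ (1 / 2 : ℝ)]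
    refine mul_le_mul ih ?_ (abs_nonneg _) (pow_nonneg (by norm_num) _)
    have hden : (0 : ℝ) < ((k : ℝ) + 1) * ((m : ℝ) + 2 + k) * ((m : ℝ) + 1 + k) * 4 := by
      positivity
    rw [abs_div, abs_of_pos hden, div_le_iff₀ hden, abs_mul,
      abs_of_nonneg (sq_nonneg ((k : ℝ) + 3 / 2))]
    have h1 : |(k : ℝ) - 1 / 2| ≤ k + 1 := by
      rw [abs_le]; constructor <;> linarith
    have h2 : ((k : ℝ) + 3 / 2) ^ 2 ≤ 2 * (((m : ℝ) + 2 + k) * ((m : ℝ) + 1 + k)) := by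
      nlinarith [mul_nonneg hm hk, mul_nonneg hm hm]
    calc |(k : ℝ) - 1 / 2| * ((k : ℝ) + 3 / 2) ^ 2
        ≤ (k + 1) * (2 * (((m : ℝ) + 2 + k) * ((m : ℝ) + 1 + k))) :=
          mul_le_mul h1 h2 (sq_nonneg _) (by positivity)
      _ = _ := by ring

lemma wzCoeff_succ_left (m k : ℕ) :
    wzCoeff (m + 1) k * (((m : ℝ) + k + 1) * ((m : ℝ) + k + 2)) =
      ((m : ℝ) + 1) * ((m : ℝ) + 2) * wzCoeff m k := by
  induction k with
  | zero => simp [wzCoeff]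
  | succ k ih =>
    have h : wzCoeff (m + 1) k =
        ((m : ℝ) + 1) * ((m : ℝ) + 2) * wzCoeff m k /
          (((m : ℝ) + k + 1) * ((m : ℝ) + k + 2)) := by
      rw [eq_div_iff (by positivity)]; exact ih
    rw [wzCoeff, wzCoeff, h]
    push_cast
    have h1 : (m : ℝ) + k + 1 ≠ 0 := by positivity
    have h2 : (m : ℝ) + k + 2 ≠ 0 := by positivity
    have h3 : (m : ℝ) + 1 + 2 + k ≠ 0 := by positivity
    have h4 : (m : ℝ) + 1 + 1 + k ≠ 0 := by positivity
    have h5 : (m : ℝ) + 2 + k ≠ 0 := by positivity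
    have h6 : (m : ℝ) + 1 + k ≠ 0 := by positivity
    field_simp
    ring

lemma wzTerm_succ_sub (m k : ℕ) :
    (4 * (m : ℝ) ^ 2 - 1) * wzTerm (m + 1) k -
        4 * ((m : ℝ) + 1) * ((m : ℝ) + 2) * wzTerm m k =
      wzCert m (k + 1) - wzCert m k := by
  have h : wzCoeff (m + 1) k =
      ((m : ℝ) + 1) * ((m : ℝ) + 2) * wzCoeff m k /
        (((m : ℝ) + k + 1) * ((m : ℝ) + k + 2)) := by
    rw [eq_div_iff (by positivity)]; exact wzCoeff_succ_left m k
  rw [wzTerm, wzTerm, wzCert, wzCert, wzPoly, wzPoly, h, wzCoeff]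
  push_cast
  have h1 : (m : ℝ) + k + 1 ≠ 0 := by positivity
  have h2 : (m : ℝ) + k + 2 ≠ 0 := by positivity
  have h3 : (k : ℝ) + 1 ≠ 0 := by positivity
  rw [show (m : ℝ) + 2 + k = m + k + 2 by ring, show (m : ℝ) + 1 + k = m + k + 1 by ring]
  field_simp
  ring

lemma summable_pow_mul_half_pow (n : ℕ) :
    Summable fun k : ℕ => (1 / 2 : ℝ) ^ k * (6 * (k : ℝ) + 4) ^ n := by
  have h := (summable_nat_add_iff 1).2
    (summable_pow_mul_geometric_of_norm_lt_one (R := ℝ) n (r := 1 / 2) (by norm_num))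
  refine Summable.of_nonneg_of_le (fun k => by positivity) (fun k => ?_)
    (h.mul_left (2 * 6 ^ n))
  have hk : (6 * (k : ℝ) + 4) ^ n ≤ (6 * ((k : ℝ) + 1)) ^ n := by
    gcongr; linarith
  calc (1 / 2 : ℝ) ^ k * (6 * (k : ℝ) + 4) ^ n
      ≤ (1 / 2 : ℝ) ^ k * (6 * ((k : ℝ) + 1)) ^ n := by gcongr
    _ = _ := by push_cast; rw [mul_pow, pow_succ]; ring

lemma abs_wzTerm_le (m k : ℕ) :
    |wzTerm m k| ≤ ((m : ℝ) + 1) ^ 3 * ((1 / 2 : ℝ) ^ k * (6 * (k : ℝ) + 4) ^ 3) := by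
  have hk : (0 : ℝ) ≤ k := k.cast_nonneg
  have hm : (0 : ℝ) ≤ m := m.cast_nonneg
  have hmk := mul_nonneg hm hk
  have hP : |wzPoly m k| ≤ (((m : ℝ) + 1) * (6 * k + 4)) ^ 3 := by
    rw [wzPoly, abs_mul, abs_mul, pow_succ, sq]
    gcongr <;> rw [abs_le] <;> constructor <;> nlinarith
  calc |wzTerm m k| = |wzCoeff m k| * |wzPoly m k| := abs_mul _ _
    _ ≤ (1 / 2 : ℝ) ^ k * (((m : ℝ) + 1) * (6 * k + 4)) ^ 3 :=
      mul_le_mul (abs_wzCoeff_le m k) hP (abs_nonneg _) (by positivity)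
    _ = _ := by ring

lemma summable_wzTerm (m : ℕ) : Summable (wzTerm m) :=
  Summable.of_norm_bounded ((summable_pow_mul_half_pow 3).mul_left _)
    fun k => abs_wzTerm_le m k

lemma summable_wzCert (m : ℕ) : Summable (wzCert m) := by
  refine Summable.of_norm_bounded
    ((summable_pow_mul_half_pow 3).mul_left (32 * (((m : ℝ) + 1) ^ 3 * ((m : ℝ) + 2))))
    fun k => ?_
  have hk : (0 : ℝ) ≤ k := k.cast_nonneg
  have hm : (0 : ℝ) ≤ m := m.cast_nonneg
  have hmk := mul_nonneg hm hk
  rw [wzCert, norm_mul, Real.norm_eq_abs, Real.norm_of_nonneg (by positivity)]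
  have h1 : 4 * (m : ℝ) + 2 * k + 1 ≤ (m + 1) * (6 * k + 4) := by nlinarith
  have h2 : (k : ℝ) ≤ 6 * k + 4 := by linarith
  calc |wzCoeff m k| *
        (((m : ℝ) + 1) * ((m : ℝ) + 2) * k * (32 * (4 * (m : ℝ) + 2 * k + 1) ^ 2))
      ≤ (1 / 2 : ℝ) ^ k * (((m : ℝ) + 1) * ((m : ℝ) + 2) * (6 * k + 4) *
          (32 * (((m : ℝ) + 1) * (6 * k + 4)) ^ 2)) := by
        gcongr
        exact abs_wzCoeff_le m k
    _ = _ := by ring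

lemma tsum_wzTerm_succ (m : ℕ) :
    (4 * (m : ℝ) ^ 2 - 1) * ∑' k, wzTerm (m + 1) k =
      4 * ((m : ℝ) + 1) * ((m : ℝ) + 2) * ∑' k, wzTerm m k := by
  have hG := summable_wzCert m
  have h0 : wzCert m 0 = 0 := by simp [wzCert]
  have hshift := hG.tsum_eq_zero_add
  rw [h0, zero_add] at hshift
  rw [← sub_eq_zero, ← tsum_mul_left, ← tsum_mul_left,
    ← ((summable_wzTerm (m + 1)).mul_left _).tsum_sub ((summable_wzTerm m).mul_left _)]
  simp_rw [wzTerm_succ_sub]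
  rw [((summable_nat_add_iff 1).2 hG).tsum_sub hG, ← hshift, sub_self]

lemma tsum_wzTerm_eq_wallis (m : ℕ) :
    ∑' k, wzTerm m k = -(∑' k, wzTerm 0 k) * Real.Wallis.W m *
      (((m : ℝ) + 1) * (2 * m - 1) * (2 * m + 1)) := by
  induction m with
  | zero => simp [Real.Wallis.W]
  | succ m ih =>
    have h1 : (2 * (m : ℝ) - 1) ≠ 0 := by
      intro h
      have h' : (2 * m : ℝ) = (1 : ℕ) := by push_cast; linarith
      have : 2 * m = 1 := by exact_mod_cast h'
      omega
    have h2 : (2 * (m : ℝ) + 1) ≠ 0 := by positivity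
    have h3 : (2 * (m : ℝ) + 3) ≠ 0 := by positivity
    have h4 : 4 * (m : ℝ) ^ 2 - 1 ≠ 0 := by
      rw [show 4 * (m : ℝ) ^ 2 - 1 = (2 * m - 1) * (2 * m + 1) by ring]
      exact mul_ne_zero h1 h2
    apply mul_left_cancel₀ h4
    rw [tsum_wzTerm_succ, ih, Real.Wallis.W_succ]
    push_cast
    field_simp
    ring

lemma tendsto_wzCoeff_succ (k : ℕ) :
    Tendsto (fun m : ℕ => wzCoeff m (k + 1)) atTop (𝓝 0) := by
  have hlim : Tendsto (fun m : ℕ => (((k : ℝ) + 3 / 2) ^ 2) * (1 / ((m : ℝ) + 1))) atTop (𝓝 0) := by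
    simpa using (tendsto_one_div_add_atTop_nhds_zero_nat (𝕜 := ℝ)).const_mul
      (((k : ℝ) + 3 / 2) ^ 2)
  refine squeeze_zero_norm (fun m => ?_) hlim
  have hk : (0 : ℝ) ≤ k := k.cast_nonneg
  have hm : (0 : ℝ) ≤ m := m.cast_nonneg
  have hc : |wzCoeff m k| ≤ 1 :=
    (abs_wzCoeff_le m k).trans (pow_le_one₀ (by norm_num) (by norm_num))
  have h1 : |(k : ℝ) - 1 / 2| ≤ k + 1 := by
    rw [abs_le]; constructor <;> linarith
  have hden : (0 : ℝ) < ((k : ℝ) + 1) * ((m : ℝ) + 2 + k) * ((m : ℝ) + 1 + k) * 4 := by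
    positivity
  rw [wzCoeff, Real.norm_eq_abs, abs_mul, abs_div, abs_of_pos hden, abs_mul,
    abs_of_nonneg (sq_nonneg ((k : ℝ) + 3 / 2))]
  calc |wzCoeff m k| * (|(k : ℝ) - 1 / 2| * ((k : ℝ) + 3 / 2) ^ 2 /
        (((k : ℝ) + 1) * ((m : ℝ) + 2 + k) * ((m : ℝ) + 1 + k) * 4))
      ≤ 1 * (((k : ℝ) + 1) * ((k : ℝ) + 3 / 2) ^ 2 /
        (((k : ℝ) + 1) * 1 * ((m : ℝ) + 1 + 0) * 1)) := by
        gcongr <;> linarith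
    _ = _ := by
        rw [add_zero]
        field_simp

lemma tendsto_wzPoly_div (k : ℕ) :
    Tendsto (fun m : ℕ => wzPoly m k / ((m : ℝ) + 1) ^ 3) atTop (𝓝 64) := by
  have hinv := tendsto_one_div_add_atTop_nhds_zero_nat (𝕜 := ℝ)
  have hlin (a : ℝ) : Tendsto (fun m : ℕ => 4 + a * (1 / ((m : ℝ) + 1))) atTop (𝓝 4) := by
    simpa using (hinv.const_mul a).const_add 4
  have h := ((hlin (6 * k - 1)).mul (hlin (2 * k - 5))).mul (hlin (2 * k - 3))
  norm_num at h
  refine h.congr fun m => ?_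
  rw [wzPoly]
  field_simp
  ring

lemma tendsto_tsum_wzTerm_div :
    Tendsto (fun m : ℕ => (∑' k, wzTerm m k) / ((m : ℝ) + 1) ^ 3) atTop (𝓝 64) := by
  have hlim (k : ℕ) : Tendsto (fun m : ℕ => wzTerm m k / ((m : ℝ) + 1) ^ 3) atTop
      (𝓝 (if k = 0 then 64 else 0)) := by
    cases k with
    | zero => simpa [wzTerm, wzCoeff] using tendsto_wzPoly_div 0
    | succ k =>
      have h := (tendsto_wzCoeff_succ k).mul (tendsto_wzPoly_div (k + 1))
      simpa [wzTerm, mul_div_assoc] using h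
  have h := tendsto_tsum_of_dominated_convergence (summable_pow_mul_half_pow 3) hlim
    (Eventually.of_forall fun m k => by
      rw [norm_div, Real.norm_eq_abs, Real.norm_of_nonneg (by positivity),
        div_le_iff₀ (by positivity), mul_comm]
      exact abs_wzTerm_le m k)
  rw [tsum_ite_eq] at h
  simpa only [tsum_div_const] using h

lemma tsum_wzTerm_zero : ∑' k, wzTerm 0 k = -32 / Real.pi := by
  have hinv := tendsto_one_div_add_atTop_nhds_zero_nat (𝕜 := ℝ)
  have hlin (a : ℝ) : Tendsto (fun m : ℕ => 2 + a * (1 / ((m : ℝ) + 1))) atTop (𝓝 2) := by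
    simpa using (hinv.const_mul a).const_add 2
  have h := (Real.Wallis.tendsto_W_nhds_pi_div_two.const_mul (-(∑' k, wzTerm 0 k))).mul
    ((hlin (-3)).mul (hlin (-1)))
  have heq := tendsto_nhds_unique tendsto_tsum_wzTerm_div (h.congr fun m => by
    rw [tsum_wzTerm_eq_wallis m]
    field_simp
    ring)
  rw [eq_div_iff Real.pi_ne_zero]
  linarith

lemma poch_succ (x : ℝ) (k : ℕ) : poch x (k + 1) = poch x k * (x + k) :=
  Finset.prod_range_succ _ _

lemma poch_cube_div_eq_wzCoeff (k : ℕ) :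
    poch (3 / 2) k ^ 3 / ((k.factorial : ℝ) ^ 2 * ((k + 1).factorial : ℝ)) / 4 ^ k =
      -((2 * (k : ℝ) + 1) * (2 * k - 1) * wzCoeff 0 k) := by
  induction k with
  | zero => simp [poch, wzCoeff]
  | succ k ih =>
    have hf : ((k.factorial : ℕ) : ℝ) ≠ 0 := by exact_mod_cast k.factorial_ne_zero
    have hstep : poch (3 / 2) (k + 1) ^ 3 /
          (((k + 1).factorial : ℝ) ^ 2 * ((k + 1 + 1).factorial : ℝ)) / 4 ^ (k + 1) =
        poch (3 / 2) k ^ 3 / ((k.factorial : ℝ) ^ 2 * ((k + 1).factorial : ℝ)) / 4 ^ k *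
          ((3 / 2 + k) ^ 3 / (((k : ℝ) + 1) ^ 2 * (k + 2) * 4)) := by
      rw [poch_succ, Nat.factorial_succ (k + 1), Nat.factorial_succ k, pow_succ (4 : ℝ)]
      push_cast
      rw [show (k : ℝ) + 1 + 1 = k + 2 by ring]
      field_simp
    rw [hstep, ih, wzCoeff]
    push_cast
    rw [show (0 : ℝ) + 2 + k = k + 2 by ring, show (0 : ℝ) + 1 + k = k + 1 by ring]
    field_simp
    ring

theorem example_thm2_p0q0r1 :
    ∑' k : ℕ, (poch (3/2) k ^ 3) / ((k.factorial : ℝ) ^ 2 * ((k + 1).factorial : ℝ)) * ((2*(k : ℝ) + 1) / (4 : ℝ) ^ k) = 32 / (3 * Real.pi) := by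
  have hterm (k : ℕ) :
      (poch (3/2) k ^ 3) / ((k.factorial : ℝ) ^ 2 * ((k + 1).factorial : ℝ)) *
        ((2*(k : ℝ) + 1) / (4 : ℝ) ^ k) = -1 / 3 * wzTerm 0 k := by
    rw [mul_div_left_comm, mul_comm, mul_comm, poch_cube_div_eq_wzCoeff, wzTerm, wzPoly]
    push_cast
    ring
  simp_rw [hterm]
  rw [tsum_mul_left, tsum_wzTerm_zero]
  field_simp
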